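/- arXiv:2208.11787 — 2 statements merged into one kernel-verified Lean document; each statement's English description precedes it below -/
import Mathlib

section
/- There exists a constant K > 0 such that for every ε ∈ (0, 1), every δ ∈ (0, 1), and every integer ρ ≥ K/(εδ)²: if X is a random variable with density φ(t) = C(ρ)(1−t²)^ρ on [−1, 1], then Pr[|X| ≥ ε] ≤ δ; equivalently, 2·C(ρ)·∫_{ε}^{1} (1−t²)^ρ dt ≤ δ. -/
/-- The normalizing constant `C(ρ) = (2ρ+1)! / ((ρ!)² · 2^{2ρ+1})`. -/
noncomputable def vandermondeC (ρ : ℕ) : ℝ :=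
  (Nat.factorial (2 * ρ + 1)) / ((Nat.factorial ρ) ^ 2 * 2 ^ (2 * ρ + 1))

theorem vandermondeC_nonneg (ρ : ℕ) : 0 ≤ vandermondeC ρ := by
  unfold vandermondeC
  positivity

theorem vandermondeC_succ (ρ : ℕ) :
    vandermondeC (ρ + 1) = vandermondeC ρ * ((2 * ρ + 3) / (2 * ρ + 2)) := by
  unfold vandermondeC
  have h1 : (Nat.factorial ρ : ℝ) ≠ 0 := by positivity
  have h2 : (ρ : ℝ) + 1 ≠ 0 := by positivity
  rw [show 2 * (ρ + 1) + 1 = 2 * ρ + 1 + 1 + 1 by ring, Nat.factorial_succ (2 * ρ + 1 + 1),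
    Nat.factorial_succ (2 * ρ + 1), Nat.factorial_succ ρ]
  push_cast
  rw [pow_succ (2 : ℝ) (2 * ρ + 1 + 1), pow_succ (2 : ℝ) (2 * ρ + 1),
    show (2 : ℝ) * ρ + 2 = 2 * (ρ + 1) by ring]
  field_simp
  ring

theorem vandermondeC_sq_le (ρ : ℕ) : vandermondeC ρ ^ 2 ≤ (2 * ρ + 1) / 4 := by
  induction ρ with
  | zero => norm_num [vandermondeC]
  | succ n ih =>
    rw [vandermondeC_succ, mul_pow]
    refine (mul_le_mul_of_nonneg_right ih (by positivity)).trans ?_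
    have hn : (0 : ℝ) ≤ n := n.cast_nonneg
    rw [div_pow, div_mul_div_comm, div_le_div_iff₀ (by positivity) (by norm_num)]
    push_cast
    nlinarith

theorem integral_mul_one_sub_sq_pow (a b : ℝ) (n : ℕ) :
    ∫ t in a..b, t * (1 - t ^ 2) ^ n =
      ((1 - a ^ 2) ^ (n + 1) - (1 - b ^ 2) ^ (n + 1)) / (2 * (n + 1)) := by
  have hn : (n : ℝ) + 1 ≠ 0 := by positivity
  have hderiv (t : ℝ) : HasDerivAt (fun t : ℝ ↦ -((1 - t ^ 2) ^ (n + 1) / (2 * ((n : ℝ) + 1))))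
      (t * (1 - t ^ 2) ^ n) t := by
    refine HasDerivAt.congr_deriv (((((hasDerivAt_id t).pow 2).const_sub 1).pow (n + 1)).div_const
      (2 * ((n : ℝ) + 1))).neg ?_
    simp
    field_simp
  rw [intervalIntegral.integral_eq_sub_of_hasDerivAt (fun t _ ↦ hderiv t)
    (Continuous.intervalIntegrable (by fun_prop) _ _)]
  ring

theorem integral_one_sub_sq_pow_le {ε : ℝ} (h0 : 0 < ε) (h1 : ε ≤ 1) (n : ℕ) :
    ∫ t in ε..1, (1 - t ^ 2) ^ n ≤ 1 / (2 * ε * (n + 1)) := by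
  calc ∫ t in ε..1, (1 - t ^ 2) ^ n
      ≤ ∫ t in ε..1, ε⁻¹ * (t * (1 - t ^ 2) ^ n) := by
        refine intervalIntegral.integral_mono_on h1
          (Continuous.intervalIntegrable (by fun_prop) _ _)
          (Continuous.intervalIntegrable (by fun_prop) _ _) fun t ht ↦ ?_
        rw [← mul_assoc]
        refine le_mul_of_one_le_left (pow_nonneg (by nlinarith [ht.1, ht.2]) n) ?_
        rw [inv_mul_eq_div, one_le_div h0]
        exact ht.1
    _ = ε⁻¹ * ((1 - ε ^ 2) ^ (n + 1) / (2 * (n + 1))) := by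
        rw [intervalIntegral.integral_const_mul, integral_mul_one_sub_sq_pow]
        simp
    _ ≤ ε⁻¹ * (1 / (2 * (n + 1))) := by
        gcongr
        exact pow_le_one₀ (by nlinarith) (by nlinarith)
    _ = 1 / (2 * ε * (n + 1)) := by
        field_simp

/-- Concentration: there is a constant `K > 0` such that for all `ε, δ ∈ (0,1)` and all
`ρ ≥ K/(εδ)²`, a random variable `X` with density `φ(t) = C(ρ)(1−t²)^ρ` on `[−1,1]`
satisfies `Pr[|X| ≥ ε] = 2·C(ρ)·∫_ε^1 (1−t²)^ρ dt ≤ δ`. -/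
theorem stmt_8 :
    ∃ K : ℝ, 0 < K ∧ ∀ ε : ℝ, 0 < ε → ε < 1 → ∀ δ : ℝ, 0 < δ → δ < 1 →
      ∀ ρ : ℕ, K / (ε * δ) ^ 2 ≤ (ρ : ℝ) →
        2 * vandermondeC ρ * ∫ t in ε..1, (1 - t ^ 2) ^ ρ ≤ δ := by
  refine ⟨1, one_pos, fun ε hε hε1 δ hδ _ ρ hρ ↦ ?_⟩
  have hC := vandermondeC_nonneg ρ
  have hρ0 : (0 : ℝ) ≤ ρ := ρ.cast_nonneg
  refine (mul_le_mul_of_nonneg_left (integral_one_sub_sq_pow_le hε hε1.le ρ)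
    (by positivity)).trans ?_
  rw [mul_one_div, div_le_iff₀ (by positivity)]
  rw [div_le_iff₀ (by positivity)] at hρ
  have key : vandermondeC ρ ≤ ε * δ * (ρ + 1) := by
    refine (abs_le_of_sq_le_sq' ?_ (by positivity)).2
    calc vandermondeC ρ ^ 2 ≤ (2 * ρ + 1) / 4 := vandermondeC_sq_le ρ
      _ ≤ 1 * (ρ + 1) := by linarith
      _ ≤ ((ρ + 1) * (ε * δ) ^ 2) * (ρ + 1) := by
        gcongr
        nlinarith [sq_nonneg (ε * δ)]
      _ = (ε * δ * (ρ + 1)) ^ 2 := by ring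
  linarith
end

section
/- There exists a constant K > 0, independent of the dimension d, with the following property. For every d ≥ 1, every ε > 0, and every odd integer c ≥ K/ε², and for every sequence of instances where the n-th instance consists of points x^{(n)}_1, …, x^{(n)}_n ∈ ℝ^d (n odd, n ≥ c) whose coordinate-wise median x_m^{(n)} has positive social cost SC_n(x_m^{(n)}) > 0 with respect to the L1 norm: limsup_{n→∞, n odd} E_S[ SC_n( coordinate-wise median of (x^{(n)}_i)_{i∈S} ) ] / SC_n(x_m^{(n)}) ≤ 1 + ε, where S is a uniformly random c-element subset of {1, …, n}. That is, in (ℝ^d, ‖·‖₁) a sample of size c = Θ(1/ε²), independent of d, yields in expectation a 1+ε approximation with respect to the optimal social cost of the full-information generalized median, as n → ∞. -/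
open Filter

/-- The median of a multiset of reals of odd size `2κ+1`: its `(κ+1)`-th smallest element. -/
noncomputable def multisetMedian (s : Multiset ℝ) : ℝ :=
  (s.sort (· ≤ ·)).getD ((Multiset.card s - 1) / 2) 0

/-- The `L¹` social cost of `y ∈ ℝ^d` w.r.t. the points `x 1, …, x n ∈ ℝ^d`. -/
noncomputable def socialCostL1 {n d : ℕ} (x : Fin n → Fin d → ℝ) (y : Fin d → ℝ) : ℝ :=
  ∑ i, ∑ j, |x i j - y j|

/-- The coordinate-wise median of the points indexed by a finset `S`. -/
noncomputable def cwMedian {n d : ℕ} (x : Fin n → Fin d → ℝ) (S : Finset (Fin n)) :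
    Fin d → ℝ :=
  fun j => multisetMedian (Multiset.map (fun i => x i j) S.val)

open Finset MeasureTheory

/-- A threshold lies below the median of an odd multiset iff it lies below most elements. -/
lemma le_multisetMedian_iff {s : Multiset ℝ} (hs : Odd (Multiset.card s)) (t : ℝ) :
    t ≤ multisetMedian s ↔ Multiset.card s < 2 * s.countP (t ≤ ·) := by
  obtain ⟨k, hk⟩ := hs
  unfold multisetMedian
  set l := s.sort (· ≤ ·) with hl
  have hlen : l.length = 2 * k + 1 := by rw [hl, Multiset.length_sort, hk]
  have hsorted : l.SortedLE := (Multiset.pairwise_sort s (· ≤ ·)).sortedLE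
  have hcount : s.countP (t ≤ ·) = l.countP (t ≤ ·) := by
    rw [← Multiset.coe_countP, hl, Multiset.sort_eq]
  have hsub : (Multiset.card s - 1) / 2 = k := by omega
  have hkl : k < l.length := by omega
  rw [hsub, hcount, hk, List.getD_eq_getElem l 0 hkl]
  constructor
  · intro h
    have hdrop : (l.drop k).countP (t ≤ ·) = (l.drop k).length := by
      rw [List.countP_eq_length]
      intro a ha
      obtain ⟨i, hi, rfl⟩ := List.mem_iff_getElem.1 ha
      rw [List.getElem_drop]
      exact decide_eq_true (h.trans (hsorted.getElem_le_getElem_of_le (by omega)))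
    have hle := (List.drop_sublist k l).countP_le (p := fun a => decide (t ≤ a))
    rw [hdrop, List.length_drop] at hle
    omega
  · intro h
    by_contra! hlt
    have htake : (l.take (k + 1)).countP (t ≤ ·) = 0 := by
      rw [List.countP_eq_zero]
      intro a ha
      obtain ⟨i, hi, rfl⟩ := List.mem_iff_getElem.1 ha
      rw [List.getElem_take]
      rw [List.length_take] at hi
      have := hsorted.getElem_le_getElem_of_le (i := i) (j := k) (hi := by omega) (hj := hkl)
        (by omega)
      simpa using this.trans_lt hlt
    have hsplit : l.countP (t ≤ ·) =
        (l.take (k + 1)).countP (t ≤ ·) + (l.drop (k + 1)).countP (t ≤ ·) := by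
      rw [← List.countP_append, List.take_append_drop]
    have hle := List.countP_le_length (p := fun a => decide (t ≤ a)) (l := l.drop (k + 1))
    rw [List.length_drop] at hle
    omega

/-- Layer-cake formula for the one-dimensional social cost. -/
lemma sum_abs_sub_eq_integral {ι : Type*} [Fintype ι] (f : ι → ℝ) (y : ℝ) :
    Integrable (fun t => (#{i | ¬ (t ≤ f i ↔ t ≤ y)} : ℝ)) ∧
      ∫ t, (#{i | ¬ (t ≤ f i ↔ t ≤ y)} : ℝ) = ∑ i, |f i - y| := by
  have hcard (t : ℝ) : (#{i | ¬ (t ≤ f i ↔ t ≤ y)} : ℝ) =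
      ∑ i, (Set.uIoc y (f i)).indicator (fun _ => (1 : ℝ)) t := by
    rw [card_filter, Nat.cast_sum]
    refine sum_congr rfl fun i _ => ?_
    simp only [Set.indicator, Nat.cast_ite, Nat.cast_one, Nat.cast_zero]
    congr 1
    grind
  have hint (i : ι) : Integrable ((Set.uIoc y (f i)).indicator (fun _ => (1 : ℝ))) := by
    rw [integrable_indicator_iff measurableSet_uIoc]
    exact integrableOn_const (by simp [Real.volume_uIoc])
  simp_rw [hcard]
  refine ⟨integrable_finsetSum _ fun i _ => hint i, ?_⟩
  rw [integral_finsetSum _ fun i _ => hint i]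
  refine sum_congr rfl fun i _ => ?_
  rw [integral_indicator measurableSet_uIoc, setIntegral_const, measureReal_def,
    Real.volume_uIoc, ENNReal.toReal_ofReal (abs_nonneg _), smul_eq_mul, mul_one]

section Sampling

variable {ι : Type*} [Fintype ι] [DecidableEq ι]

lemma card_mul_card_filter_mem_powersetCard (c : ℕ) (i : ι) :
    Fintype.card ι * #{S ∈ powersetCard c (univ : Finset ι) | i ∈ S} =
      c * (Fintype.card ι).choose c := by
  rcases c with _ | c
  · simp
  have h := card_filter_powersetCard_subset {i} univ (c + 1) (subset_univ _) (by simp)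
  simp only [singleton_subset_iff, card_singleton, card_univ, Nat.add_sub_cancel] at h
  obtain ⟨m, hm⟩ : ∃ m, Fintype.card ι = m + 1 :=
    Nat.exists_eq_succ_of_ne_zero (Fintype.card_pos_iff.2 ⟨i⟩).ne'
  rw [h, hm, Nat.add_sub_cancel, Nat.add_one_mul_choose_eq, mul_comm]

lemma card_mul_card_filter_pair_mem_powersetCard (c : ℕ) {i j : ι} (hij : i ≠ j) :
    Fintype.card ι * (Fintype.card ι - 1) *
        #{S ∈ powersetCard c (univ : Finset ι) | i ∈ S ∧ j ∈ S} =
      c * (c - 1) * (Fintype.card ι).choose c := by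
  rcases Nat.lt_or_ge c 2 with hc | hc
  · have h0 : #{S ∈ powersetCard c (univ : Finset ι) | i ∈ S ∧ j ∈ S} = 0 := by
      rw [card_eq_zero, filter_eq_empty_iff]
      rintro S hS ⟨hi, hj⟩
      have := one_lt_card.2 ⟨i, hi, j, hj, hij⟩
      rw [(mem_powersetCard.1 hS).2] at this
      omega
    have : c * (c - 1) = 0 := by interval_cases c <;> rfl
    rw [h0, this, mul_zero, zero_mul]
  · obtain ⟨e, rfl⟩ := Nat.exists_eq_add_of_le' hc
    have hcard := card_pair hij
    have h := card_filter_powersetCard_subset {i, j} univ (e + 2) (subset_univ _) (by omega)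
    simp only [insert_subset_iff, singleton_subset_iff, hcard, card_univ,
      Nat.add_sub_cancel] at h
    have hn : 2 ≤ Fintype.card ι := by
      rw [← hcard]
      exact card_le_univ _
    obtain ⟨m, hm⟩ := Nat.exists_eq_add_of_le' hn
    rw [h, hm, Nat.add_sub_cancel]
    have h1 := Nat.add_one_mul_choose_eq m e
    have h2 := Nat.add_one_mul_choose_eq (m + 1) (e + 1)
    have e1 : m + 2 - 1 = m + 1 := rfl
    have e2 : e + 2 - 1 = e + 1 := rfl
    rw [e1, e2]
    calc (m + 2) * (m + 1) * m.choose e = (m + 2) * ((m + 1) * m.choose e) := by ring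
      _ = (m + 1 + 1) * (m + 1).choose (e + 1) * (e + 1) := by rw [h1]; ring
      _ = _ := by rw [h2]; ring

/-- First moment of the hypergeometric distribution. -/
lemma card_mul_sum_card_inter (c : ℕ) (U : Finset ι) :
    (Fintype.card ι : ℝ) * ∑ S ∈ powersetCard c (univ : Finset ι), (#(S ∩ U) : ℝ) =
      c * #U * (Fintype.card ι).choose c := by
  have hswap : ∑ S ∈ powersetCard c (univ : Finset ι), (#(S ∩ U) : ℝ) =
      ∑ i ∈ U, (#{S ∈ powersetCard c (univ : Finset ι) | i ∈ S} : ℝ) := by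
    simp_rw [inter_comm _ U, ← filter_mem_eq_inter, card_filter, Nat.cast_sum]
    rw [sum_comm]
  have hterm (i : ι) : (Fintype.card ι : ℝ) *
      (#{S ∈ powersetCard c (univ : Finset ι) | i ∈ S} : ℝ) =
        c * (Fintype.card ι).choose c := by
    exact_mod_cast card_mul_card_filter_mem_powersetCard c i
  rw [hswap, mul_sum, sum_congr rfl fun i _ => hterm i, sum_const, nsmul_eq_mul]
  ring

/-- Second moment of the hypergeometric distribution. -/
lemma card_mul_sum_card_inter_sq {c : ℕ} (hc : 1 ≤ c) [Nonempty ι] (U : Finset ι) :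
    (Fintype.card ι : ℝ) * (Fintype.card ι - 1) *
        ∑ S ∈ powersetCard c (univ : Finset ι), (#(S ∩ U) : ℝ) ^ 2 =
      (c * #U * (Fintype.card ι - 1) + c * (c - 1) * (#U * (#U - 1))) *
        (Fintype.card ι).choose c := by
  have hn : 1 ≤ Fintype.card ι := Fintype.card_pos
  have hsq (S : Finset ι) : (#(S ∩ U) : ℝ) ^ 2 =
      ∑ i ∈ U, ∑ j ∈ U, if i ∈ S ∧ j ∈ S then (1 : ℝ) else 0 := by
    rw [inter_comm, ← filter_mem_eq_inter, card_filter, Nat.cast_sum, sq, sum_mul_sum]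
    refine sum_congr rfl fun i _ => sum_congr rfl fun j _ => ?_
    by_cases hi : i ∈ S <;> by_cases hj : j ∈ S <;> simp [hi, hj]
  have hswap : ∑ S ∈ powersetCard c (univ : Finset ι), (#(S ∩ U) : ℝ) ^ 2 =
      ∑ i ∈ U, ∑ j ∈ U,
        (#{S ∈ powersetCard c (univ : Finset ι) | i ∈ S ∧ j ∈ S} : ℝ) := by
    simp_rw [hsq, card_filter, Nat.cast_sum, Nat.cast_ite, Nat.cast_one, Nat.cast_zero]
    rw [sum_comm]
    exact sum_congr rfl fun i _ => sum_comm
  have hdiag (i : ι) : (Fintype.card ι : ℝ) * (Fintype.card ι - 1) *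
      (#{S ∈ powersetCard c (univ : Finset ι) | i ∈ S ∧ i ∈ S} : ℝ) =
        c * (Fintype.card ι - 1) * (Fintype.card ι).choose c := by
    have h : (Fintype.card ι : ℝ) * (#{S ∈ powersetCard c (univ : Finset ι) | i ∈ S} : ℝ) =
        c * (Fintype.card ι).choose c := by
      exact_mod_cast card_mul_card_filter_mem_powersetCard c i
    simp_rw [and_self]
    linear_combination ((Fintype.card ι : ℝ) - 1) * h
  have hoff {i j : ι} (hij : i ≠ j) : (Fintype.card ι : ℝ) * (Fintype.card ι - 1) *
      (#{S ∈ powersetCard c (univ : Finset ι) | i ∈ S ∧ j ∈ S} : ℝ) =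
        c * (c - 1) * (Fintype.card ι).choose c := by
    have h := card_mul_card_filter_pair_mem_powersetCard c hij
    have h' := congrArg (Nat.cast (R := ℝ)) h
    push_cast [Nat.cast_sub hn, Nat.cast_sub hc] at h'
    exact h'
  have hrow {i : ι} (hi : i ∈ U) : (Fintype.card ι : ℝ) * (Fintype.card ι - 1) *
      ∑ j ∈ U, (#{S ∈ powersetCard c (univ : Finset ι) | i ∈ S ∧ j ∈ S} : ℝ) =
        (c * (Fintype.card ι - 1) + (#U - 1) * (c * (c - 1))) *
          (Fintype.card ι).choose c := by
    rw [← add_sum_erase U _ hi, mul_add, hdiag, mul_sum,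
      sum_congr rfl fun j hj => hoff (ne_of_mem_erase hj).symm, sum_const, nsmul_eq_mul,
      card_erase_of_mem hi, Nat.cast_sub (card_pos.2 ⟨i, hi⟩)]
    push_cast
    ring
  rw [hswap, mul_sum, sum_congr rfl fun i hi => hrow hi, sum_const, nsmul_eq_mul]
  ring

/-- Second moment of the hypergeometric distribution about its mean. -/
lemma sum_card_inter_sub_sq_le {c : ℕ} (hc : 1 ≤ c) (hcn : c ≤ Fintype.card ι) (U : Finset ι) :
    ∑ S ∈ powersetCard c (univ : Finset ι),
        ((Fintype.card ι : ℝ) * #(S ∩ U) - c * #U) ^ 2 ≤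
      c * #U * (Fintype.card ι - #U) * (Fintype.card ι).choose c := by
  have : Nonempty ι := Fintype.card_pos_iff.1 (by omega)
  have h1 := card_mul_sum_card_inter c U
  have h2 := card_mul_sum_card_inter_sq hc U
  have hu : (#U : ℝ) ≤ Fintype.card ι := by exact_mod_cast card_le_univ U
  have hc' : (1 : ℝ) ≤ c := by exact_mod_cast hc
  have hcn' : (c : ℝ) ≤ Fintype.card ι := by exact_mod_cast hcn
  have hexp : ∑ S ∈ powersetCard c (univ : Finset ι),
      ((Fintype.card ι : ℝ) * #(S ∩ U) - c * #U) ^ 2 =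
      (Fintype.card ι : ℝ) ^ 2 * ∑ S ∈ powersetCard c (univ : Finset ι), (#(S ∩ U) : ℝ) ^ 2
        - 2 * c * #U * (Fintype.card ι *
          ∑ S ∈ powersetCard c (univ : Finset ι), (#(S ∩ U) : ℝ))
        + c ^ 2 * #U ^ 2 * (Fintype.card ι).choose c := by
    simp_rw [sub_sq, mul_pow, sum_add_distrib, sum_sub_distrib, mul_sum, sum_const,
      card_powersetCard, card_univ, nsmul_eq_mul]
    congr 1
    · congr 1
      exact sum_congr rfl fun S _ => by ring
    · ring
  have hpos : 0 ≤ (c : ℝ) * #U * (Fintype.card ι - #U) * (Fintype.card ι).choose c :=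
    mul_nonneg (mul_nonneg (by positivity) (sub_nonneg.2 hu)) (by positivity)
  have hvar : ((Fintype.card ι : ℝ) - 1) * ∑ S ∈ powersetCard c (univ : Finset ι),
      ((Fintype.card ι : ℝ) * #(S ∩ U) - c * #U) ^ 2 =
      (Fintype.card ι - c) *
        (c * #U * (Fintype.card ι - #U) * (Fintype.card ι).choose c) := by
    rw [hexp, h1]
    linear_combination (Fintype.card ι : ℝ) * h2
  rcases hcn.eq_or_lt with heq | hlt
  · have hzero : ∀ S ∈ powersetCard c (univ : Finset ι),
        ((Fintype.card ι : ℝ) * #(S ∩ U) - c * #U) ^ 2 = 0 := by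
      intro S hS
      have hS' : S = univ := by
        rw [← card_eq_iff_eq_univ, (mem_powersetCard.1 hS).2, heq]
      rw [hS', univ_inter, ← heq, sub_self, zero_pow two_ne_zero]
    rw [sum_eq_zero hzero]
    exact hpos
  · have hlt' : (c : ℝ) < Fintype.card ι := by exact_mod_cast hlt
    refine le_of_mul_le_mul_left ?_ (show 0 < (Fintype.card ι : ℝ) - 1 by linarith)
    rw [hvar]
    exact mul_le_mul_of_nonneg_right (by linarith) hpos

/-- A minority `U` is rarely a majority of the sample. -/
lemma card_majority_mul_le {c : ℕ} (hc : 1 ≤ c) (hcn : c ≤ Fintype.card ι) {ε : ℝ} (hε : 0 < ε)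
    (hcε : 8 ≤ c * ε ^ 2) (U : Finset ι) (hU : 2 * #U < Fintype.card ι) :
    (#{S ∈ powersetCard c (univ : Finset ι) | c < 2 * #(S ∩ U)} : ℝ) *
        (Fintype.card ι - 2 * #U) ≤
      ε * #U * (Fintype.card ι).choose c := by
  have hU' : (2 : ℝ) * #U < Fintype.card ι := by exact_mod_cast hU
  have hc' : (0 : ℝ) < c := by exact_mod_cast hc
  have hn : (0 : ℝ) < Fintype.card ι := by exact_mod_cast hc.trans hcn
  have hmarkov : (#{S ∈ powersetCard c (univ : Finset ι) | c < 2 * #(S ∩ U)} : ℝ) * c ≤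
      2 * ∑ S ∈ powersetCard c (univ : Finset ι), (#(S ∩ U) : ℝ) := by
    rw [← nsmul_eq_mul, ← sum_const, mul_sum]
    refine (sum_le_sum fun S hS => ?_).trans
      (sum_le_sum_of_subset_of_nonneg (filter_subset _ _) fun _ _ _ => by positivity)
    exact_mod_cast (mem_filter.1 hS).2.le
  have hcheb : (#{S ∈ powersetCard c (univ : Finset ι) | c < 2 * #(S ∩ U)} : ℝ) *
      (c * (Fintype.card ι - 2 * #U) / 2) ^ 2 ≤
      ∑ S ∈ powersetCard c (univ : Finset ι),
        ((Fintype.card ι : ℝ) * #(S ∩ U) - c * #U) ^ 2 := by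
    rw [← nsmul_eq_mul, ← sum_const]
    refine (sum_le_sum fun S hS => ?_).trans
      (sum_le_sum_of_subset_of_nonneg (filter_subset _ _) fun _ _ _ => by positivity)
    have hS' : (c : ℝ) ≤ 2 * #(S ∩ U) := by exact_mod_cast (mem_filter.1 hS).2.le
    refine pow_le_pow_left₀ (by nlinarith) ?_ 2
    nlinarith
  have hvar := hcheb.trans (sum_card_inter_sub_sq_le hc hcn U)
  have hmean := card_mul_sum_card_inter c U
  set n : ℝ := (Fintype.card ι : ℝ)
  set N : ℝ := (#{S ∈ powersetCard c (univ : Finset ι) | c < 2 * #(S ∩ U)} : ℝ)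
  set u : ℝ := (#U : ℝ)
  set C : ℝ := ((Fintype.card ι).choose c : ℝ)
  set w := n - 2 * u with hw
  have hN : 0 ≤ N := by positivity
  have hu : 0 ≤ u := by positivity
  have hC : 0 ≤ C := by positivity
  have hwpos : 0 < w := by linarith
  rcases le_total w (ε * n / 2) with hsmall | hlarge
  · have hNn : N * n ≤ 2 * u * C := by
      refine le_of_mul_le_mul_left ?_ hc'
      nlinarith [mul_le_mul_of_nonneg_left hmarkov hn.le]
    calc N * w ≤ N * (ε * n / 2) := mul_le_mul_of_nonneg_left hsmall hN
      _ = ε / 2 * (N * n) := by ring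
      _ ≤ ε / 2 * (2 * u * C) := mul_le_mul_of_nonneg_left hNn (by positivity)
      _ = ε * u * C := by ring
  · have hNw : c * (N * w) * w ≤ 4 * u * n * C := by
      refine le_of_mul_le_mul_left ?_ hc'
      have : (c : ℝ) * u * (n - u) * C ≤ c * u * n * C := by gcongr; linarith
      nlinarith
    have h3 : c * (N * w) * (ε * n / 2) ≤ 4 * u * n * C :=
      (mul_le_mul_of_nonneg_left hlarge (by positivity)).trans hNw
    have h4 : c * ε * (N * w) ≤ 8 * (u * C) := by
      refine le_of_mul_le_mul_left ?_ hn
      nlinarith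
    have h5 : c * ε * (N * w) ≤ c * ε * (ε * u * C) := by
      refine h4.trans ?_
      calc 8 * (u * C) ≤ (c * ε ^ 2) * (u * C) := by gcongr
        _ = _ := by ring
    exact le_of_mul_le_mul_left h5 (by positivity)

/-- The median of the values `f i`, `i ∈ S`, is at least `t` iff most of them are. -/
lemma le_multisetMedian_map_iff (f : ι → ℝ) {S : Finset ι} (hS : Odd #S) (t : ℝ) :
    t ≤ multisetMedian (S.val.map f) ↔ #S < 2 * #(S ∩ ({i | t ≤ f i} : Finset ι)) := by
  rw [le_multisetMedian_iff (by simpa using hS), Multiset.card_map, Multiset.countP_map,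
    card_val, ← filter_val, card_val, inter_filter, inter_univ]

/-- The number of voters on the other side of a threshold from an alternative which lies above
it iff `p`, where `U` is the set of voters above the threshold. -/
lemma card_filter_separated (U : Finset ι) (p : Prop) [Decidable p] :
    (#{i | ¬ (i ∈ U ↔ p)} : ℝ) = if p then (Fintype.card ι - #U : ℝ) else #U := by
  split_ifs with h
  · rw [← Nat.cast_sub (card_le_univ U), ← card_compl]
    congr 2
    ext i
    simp [h]
  · congr 2
    ext i
    simp [h]

/-- Replacing the majority by the majority of a random sample increases the expected number of
disagreeing voters by a factor of at most `1 + ε`, when `U` is a minority. -/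
lemma sum_separated_le_of_minority {c : ℕ} (hc : 1 ≤ c) (hcn : c ≤ Fintype.card ι) {ε : ℝ}
    (hε : 0 < ε) (hcε : 8 ≤ c * ε ^ 2) (U : Finset ι) (hU : 2 * #U < Fintype.card ι) :
    ∑ S ∈ powersetCard c (univ : Finset ι), (#{i | ¬ (i ∈ U ↔ c < 2 * #(S ∩ U))} : ℝ) ≤
      (1 + ε) * (Fintype.card ι).choose c * #U := by
  have hterm (S : Finset ι) : (#{i | ¬ (i ∈ U ↔ c < 2 * #(S ∩ U))} : ℝ) =
      #U + if c < 2 * #(S ∩ U) then (Fintype.card ι - 2 * #U : ℝ) else 0 := by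
    rw [card_filter_separated]
    split_ifs <;> ring
  simp_rw [hterm, sum_add_distrib, ← sum_filter, sum_const, card_powersetCard, card_univ,
    nsmul_eq_mul]
  linarith [card_majority_mul_le hc hcn hε hcε U hU]

lemma sum_separated_le {c : ℕ} (hc : Odd c) (hcn : c ≤ Fintype.card ι)
    (hn : Odd (Fintype.card ι)) {ε : ℝ} (hε : 0 < ε) (hcε : 8 ≤ c * ε ^ 2) (U : Finset ι) :
    ∑ S ∈ powersetCard c (univ : Finset ι), (#{i | ¬ (i ∈ U ↔ c < 2 * #(S ∩ U))} : ℝ) ≤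
      (1 + ε) * (Fintype.card ι).choose c *
        #{i | ¬ (i ∈ U ↔ Fintype.card ι < 2 * #U)} := by
  rw [card_filter_separated]
  split_ifs with h
  · have hcompl := card_compl U
    have hle := card_le_univ U
    have hmin := sum_separated_le_of_minority hc.pos hcn hε hcε Uᶜ (by omega)
    rw [hcompl, Nat.cast_sub hle] at hmin
    refine le_of_eq_of_le (sum_congr rfl fun S hS => ?_) hmin
    have hsplit : #(S ∩ U) + #(S ∩ Uᶜ) = c := by
      rw [← (mem_powersetCard.1 hS).2, ← sdiff_eq_inter_compl, card_inter_add_card_sdiff]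
    have hiff : c < 2 * #(S ∩ U) ↔ ¬ c < 2 * #(S ∩ Uᶜ) := by
      obtain ⟨k, hk⟩ := hc
      omega
    congr 2
    ext i
    simp only [mem_filter, mem_univ, true_and, mem_compl, hiff]
    tauto
  · obtain ⟨k, hk⟩ := hn
    exact sum_separated_le_of_minority hc.pos hcn hε hcε U (by omega)

/-- One-dimensional sampling median theorem. -/
lemma sum_socialCost_sampleMedian_le {c : ℕ} (hc : Odd c) (hcn : c ≤ Fintype.card ι)
    (hn : Odd (Fintype.card ι)) {ε : ℝ} (hε : 0 < ε) (hcε : 8 ≤ c * ε ^ 2) (f : ι → ℝ) :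
    ∑ S ∈ powersetCard c (univ : Finset ι), ∑ i, |f i - multisetMedian (S.val.map f)| ≤
      (1 + ε) * (Fintype.card ι).choose c *
        ∑ i, |f i - multisetMedian ((univ : Finset ι).val.map f)| := by
  simp_rw [← (sum_abs_sub_eq_integral f _).2]
  rw [← integral_finsetSum _ fun S _ => (sum_abs_sub_eq_integral f _).1, ← integral_const_mul]
  refine integral_mono (integrable_finsetSum _ fun S _ => (sum_abs_sub_eq_integral f _).1)
    ((sum_abs_sub_eq_integral f _).1.const_mul _) fun t => ?_
  have h := sum_separated_le hc hcn hn hε hcε {i | t ≤ f i}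
  have huniv := le_multisetMedian_map_iff f (S := univ) (by simpa using hn) t
  rw [univ_inter, card_univ] at huniv
  simp only [mem_filter, mem_univ, true_and, ← huniv] at h
  refine le_of_eq_of_le (sum_congr rfl fun S hS => ?_) h
  have hScard := (mem_powersetCard.1 hS).2
  have hmed := le_multisetMedian_map_iff f (S := S) (hScard ▸ hc) t
  rw [hScard] at hmed
  simp only [hmed]

end Sampling

lemma socialCostL1_eq_sum_coordinates {n d : ℕ} (x : Fin n → Fin d → ℝ) (y : Fin d → ℝ) :
    socialCostL1 x y = ∑ j, ∑ i, |x i j - y j| :=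
  sum_comm

lemma socialCostL1_nonneg {n d : ℕ} (x : Fin n → Fin d → ℝ) (y : Fin d → ℝ) :
    0 ≤ socialCostL1 x y :=
  sum_nonneg fun _ _ => sum_nonneg fun _ _ => abs_nonneg _

lemma sum_socialCostL1_cwMedian_le {n d c : ℕ} (hc : Odd c) (hcn : c ≤ n) (hn : Odd n) {ε : ℝ}
    (hε : 0 < ε) (hcε : 8 ≤ c * ε ^ 2) (x : Fin n → Fin d → ℝ) :
    ∑ S ∈ powersetCard c univ, socialCostL1 x (cwMedian x S) ≤
      (1 + ε) * n.choose c * socialCostL1 x (cwMedian x univ) := by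
  simp_rw [socialCostL1_eq_sum_coordinates]
  rw [sum_comm, mul_sum]
  refine sum_le_sum fun j _ => ?_
  simpa [cwMedian] using sum_socialCost_sampleMedian_le hc (by simpa using hcn)
    (by simpa using hn) hε hcε fun i => x i j

/-- High-dimensional sampling median: there exists `K > 0`, independent of the dimension `d`,
such that for every `d ≥ 1`, every `ε > 0` and every odd sample size `c ≥ K/ε²`, and every
sequence of instances `x κ : Fin (2κ+1) → ℝ^d` whose coordinate-wise median has positive `L¹`
social cost, the expected social cost of the coordinate-wise median of a uniformly random
`c`-element subset of agents is at most `(1+ε)` times optimal as `n = 2κ+1 → ∞`. -/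
theorem stmt_11 :
    ∃ K : ℝ, 0 < K ∧ ∀ d : ℕ, 1 ≤ d → ∀ ε : ℝ, 0 < ε → ∀ c : ℕ, Odd c → K / ε ^ 2 ≤ (c : ℝ) →
      ∀ x : (κ : ℕ) → Fin (2 * κ + 1) → Fin d → ℝ,
        (∀ κ : ℕ, c ≤ 2 * κ + 1 →
          0 < socialCostL1 (x κ) (cwMedian (x κ) Finset.univ)) →
        limsup (fun κ : ℕ =>
            ((∑ S ∈ Finset.powersetCard c (Finset.univ : Finset (Fin (2 * κ + 1))),
                socialCostL1 (x κ) (cwMedian (x κ) S))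
              / ((2 * κ + 1).choose c : ℝ))
            / socialCostL1 (x κ) (cwMedian (x κ) Finset.univ))
          atTop ≤ 1 + ε := by
  refine ⟨8, by norm_num, fun d _ ε hε c hc hcε x hpos => ?_⟩
  rw [div_le_iff₀ (by positivity)] at hcε
  refine limsup_le_of_le (isCoboundedUnder_le_of_le atTop (x := 0) fun κ => ?_) ?_
  · exact div_nonneg (div_nonneg (sum_nonneg fun _ _ => socialCostL1_nonneg _ _)
      (Nat.cast_nonneg _)) (socialCostL1_nonneg _ _)
  · filter_upwards [eventually_ge_atTop c] with κ hκ
    have hcn : c ≤ 2 * κ + 1 := by omega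
    have hchoose : (0 : ℝ) < (2 * κ + 1).choose c := by exact_mod_cast Nat.choose_pos hcn
    rw [div_div, div_le_iff₀ (mul_pos hchoose (hpos κ hcn)), ← mul_assoc]
    exact sum_socialCostL1_cwMedian_le hc hcn ⟨κ, rfl⟩ hε hcε (x κ)
end
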